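/- Let ε > 0 and suppose g ∈ D(A*) decomposes both as g = f_ε + u_ε − v_ε with f_ε ∈ D(A), u_ε ∈ ker(A* − iε), v_ε ∈ ker(A* + iε), and as g = f + B u₁ + u₀ with f ∈ D(A), u₀, u₁ ∈ ker A*. Then A*(u_ε − v_ε) = iε·(u_ε + v_ε) and ‖iε·(u_ε + v_ε) − u₁‖ ≤ ε·(‖g‖ + C·‖A* g‖). -/

import Mathlib

open Complex Filter
open scoped ComplexInnerProductSpace

noncomputable section

variable {H : Type*} [NormedAddCommGroup H] [InnerProductSpace ℂ H] [CompleteSpace H]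

/-- The eigenspace `ker (T - z·1)` of a partially defined linear operator `T`. -/
def pKer (T : H →ₗ.[ℂ] H) (z : ℂ) : Submodule ℂ H where
  carrier := {u : H | ∃ hu : u ∈ T.domain, T ⟨u, hu⟩ = z • u}
  zero_mem' := ⟨T.domain.zero_mem, by
    have h0 : (⟨0, T.domain.zero_mem⟩ : T.domain) = 0 := rfl
    rw [h0, T.map_zero, smul_zero]⟩
  add_mem' := by
    rintro a b ⟨ha, hTa⟩ ⟨hb, hTb⟩
    refine ⟨T.domain.add_mem ha hb, ?_⟩
    have h : (⟨a + b, T.domain.add_mem ha hb⟩ : T.domain) = ⟨a, ha⟩ + ⟨b, hb⟩ := rfl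
    rw [h, T.map_add, hTa, hTb, smul_add]
  smul_mem' := by
    rintro c a ⟨ha, hTa⟩
    refine ⟨T.domain.smul_mem c ha, ?_⟩
    have h : (⟨c • a, T.domain.smul_mem c ha⟩ : T.domain) = c • (⟨a, ha⟩ : T.domain) := rfl
    rw [h, T.map_smul, hTa, smul_comm]

/-- Orthogonal projection onto a closed submodule, as a map `H →L[ℂ] H`. -/
def projCl (W : Submodule ℂ H) (hW : IsClosed (W : Set H)) : H →L[ℂ] H :=
  letI : CompleteSpace W := hW.completeSpace_coe
  W.subtypeL.comp W.orthogonalProjectionOnto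

/-- The boundary map `Γ₁ε⁻ g = P_{ker(T - iε)} (T g + iε g)`. -/
def Gamma1m (T : H →ₗ.[ℂ] H) (hker : ∀ z : ℂ, IsClosed ((pKer T z : Set H)))
    (ε : ℝ) (g : T.domain) : H :=
  projCl (pKer T ((ε : ℂ) * I)) (hker _) (T g + ((ε : ℂ) * I) • (g : H))

/-- The boundary map `Γ₁ε⁺ g = P_{ker(T + iε)} (T g - iε g)`. -/
def Gamma1p (T : H →ₗ.[ℂ] H) (hker : ∀ z : ℂ, IsClosed ((pKer T z : Set H)))
    (ε : ℝ) (g : T.domain) : H :=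
  projCl (pKer T (-((ε : ℂ) * I))) (hker _) (T g - ((ε : ℂ) * I) • (g : H))

/-- The map `Υε g = (2iε)⁻¹ (Γ₁ε⁻ g - Γ₁ε⁺ g)`. -/
def Ups (T : H →ₗ.[ℂ] H) (hker : ∀ z : ℂ, IsClosed ((pKer T z : Set H)))
    (ε : ℝ) (g : T.domain) : H :=
  (2 * (ε : ℂ) * I)⁻¹ • (Gamma1m T hker ε g - Gamma1p T hker ε g)

/-- Elements of `pKer T z` give points `(u, z • u)` of the graph of `T`. -/
theorem mem_graph_of_mem_pKer {E : Type*} [NormedAddCommGroup E] [InnerProductSpace ℂ E]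
    {T : E →ₗ.[ℂ] E} {z : ℂ} {u : E} (hu : u ∈ pKer T z) :
    (u, z • u) ∈ T.graph := by
  obtain ⟨h, hT⟩ := hu
  exact T.mem_graph_iff.2 ⟨⟨u, h⟩, rfl, hT⟩

/-- The adjoint identity, phrased for points of the graph of the adjoint. -/
theorem inner_apply_eq_inner_of_mem_graph_adjoint {A : H →ₗ.[ℂ] H}
    (hdense : Dense (A.domain : Set H)) {x y : H} (hxy : (x, y) ∈ A.adjoint.graph)
    (h : A.domain) : ⟪A h, x⟫ = ⟪(h : H), y⟫ := by
  obtain ⟨x', rfl, rfl⟩ := A.adjoint.mem_graph_iff.1 hxy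
  exact (A.adjoint_isFormalAdjoint hdense).symm h x'

/-- A self-adjoint extension of a densely defined operator is a restriction of its adjoint. -/
theorem le_adjoint_of_le_of_adjoint_eq {A S : H →ₗ.[ℂ] H} (hdense : Dense (A.domain : Set H))
    (hS : S.adjoint = S) (hAS : A ≤ S) : S ≤ A.adjoint := by
  have hSdense : Dense (S.domain : Set H) := hdense.mono hAS.1
  refine LinearPMap.IsFormalAdjoint.le_adjoint hdense fun x y => ?_
  have h := S.adjoint_isFormalAdjoint hSdense
  rw [hS] at h
  rw [hAS.2 (x := x) (y := ⟨x, hAS.1 x.2⟩) rfl]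
  exact h ⟨x, hAS.1 x.2⟩ y

/-- If `A* w = -ε² m`, then `f + m` and `A f + w` satisfy a Pythagorean identity. -/
theorem norm_sq_add_eq_of_mem_graph_adjoint {A : H →ₗ.[ℂ] H}
    (hdense : Dense (A.domain : Set H)) {ε : ℝ} {m w : H}
    (hw : (w, -((ε : ℂ) ^ 2) • m) ∈ A.adjoint.graph) (f : A.domain) :
    ‖A f + w‖ ^ 2 + ε ^ 2 * ‖(f : H) + m‖ ^ 2 =
      ‖A f‖ ^ 2 + ‖w‖ ^ 2 + ε ^ 2 * (‖(f : H)‖ ^ 2 + ‖m‖ ^ 2) := by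
  have hcross := congrArg Complex.re (inner_apply_eq_inner_of_mem_graph_adjoint hdense hw f)
  rw [inner_smul_right, ← Complex.ofReal_pow, ← Complex.ofReal_neg, Complex.re_ofReal_mul]
    at hcross
  have h1 := norm_add_sq (𝕜 := ℂ) (A f) w
  have h2 := norm_add_sq (𝕜 := ℂ) (f : H) m
  simp only [RCLike.re_eq_complex_re] at h1 h2
  rw [h1, h2]
  linear_combination 2 * hcross

theorem le_of_sq_le_mul {x y : ℝ} (hx : 0 ≤ x) (hy : 0 ≤ y) (h : x ^ 2 ≤ x * y) : x ≤ y := by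
  rcases hx.eq_or_lt with rfl | hx
  · exact hy
  · exact le_of_mul_le_mul_left (by rwa [← sq]) hx

theorem statement_14
    (A : H →ₗ.[ℂ] H)
    (hdense : Dense (A.domain : Set H))
    (hclosed : A.IsClosed)
    (hsym : ∀ f g : A.domain, ⟪(f : H), (A g : H)⟫ = ⟪(A f : H), (g : H)⟫)
    (C : ℝ) (hC : 0 < C)
    (hbound : ∀ f : A.domain, ‖(f : H)‖ ≤ C * ‖A f‖)
    (hker : ∀ z : ℂ, IsClosed ((pKer A.adjoint z : Set H)))
    (SD : H →ₗ.[ℂ] H) (hSDsa : SD.adjoint = SD) (hASD : A ≤ SD)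
    (B : H →L[ℂ] H) (b : ℝ) (hb : ‖B‖ = b)
    (hB1 : ∀ x : SD.domain, B (SD x) = x)
    (hB2 : ∀ y : H, ∃ hy : B y ∈ SD.domain, SD ⟨B y, hy⟩ = y)
    (ε : ℝ) (hε : 0 < ε) (g : A.adjoint.domain)
    (fε : A.domain) (uε vε : H)
    (huε : uε ∈ pKer A.adjoint ((ε : ℂ) * I))
    (hvε : vε ∈ pKer A.adjoint (-((ε : ℂ) * I)))
    (hgε : (g : H) = (fε : H) + uε - vε)
    (f : A.domain) (u₀ u₁ : H)
    (hu₀ : u₀ ∈ pKer A.adjoint 0) (hu₁ : u₁ ∈ pKer A.adjoint 0)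
    (hg : (g : H) = (f : H) + B u₁ + u₀)
    (huv : uε - vε ∈ A.adjoint.domain) :
    A.adjoint ⟨uε - vε, huv⟩ = ((ε : ℂ) * I) • (uε + vε) ∧
    ‖((ε : ℂ) * I) • (uε + vε) - u₁‖ ≤ ε * (‖(g : H)‖ + C * ‖A.adjoint g‖) := by
  have hSA := le_adjoint_of_le_of_adjoint_eq hdense hSDsa hASD
  have hAA := LinearPMap.le_graph_of_le (hASD.trans hSA)
  have hu := mem_graph_of_mem_pKer huε
  have hv := mem_graph_of_mem_pKer hvε
  have hm : (uε - vε, ((ε : ℂ) * I) • (uε + vε)) ∈ A.adjoint.graph := by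
    have h := sub_mem hu hv
    rwa [Prod.mk_sub_mk, neg_smul, sub_neg_eq_add, ← smul_add] at h
  have hw : (((ε : ℂ) * I) • (uε + vε), -((ε : ℂ) ^ 2) • (uε - vε)) ∈ A.adjoint.graph := by
    have h := A.adjoint.graph.smul_mem ((ε : ℂ) * I) (add_mem hu hv)
    rw [Prod.mk_add_mk, Prod.smul_mk] at h
    convert h using 2
    have hI : ((ε : ℂ) * I) * ((ε : ℂ) * I) = -((ε : ℂ) ^ 2) := by
      linear_combination (ε : ℂ) ^ 2 * I_sq
    rw [neg_smul _ vε, ← sub_eq_add_neg, ← smul_sub, smul_smul, hI]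
  have hgε' : A.adjoint g = A fε + ((ε : ℂ) * I) • (uε + vε) := by
    refine A.adjoint.mem_graph_snd_inj (A.adjoint.mem_graph g)
      (add_mem (hAA (A.mem_graph fε)) hm) ?_
    rw [hgε, add_sub_assoc]
  have hBu₁ : (B u₁, u₁) ∈ A.adjoint.graph := by
    obtain ⟨hy, hSB⟩ := hB2 u₁
    exact LinearPMap.le_graph_of_le hSA (SD.mem_graph_iff.2 ⟨_, rfl, hSB⟩)
  have hg' : A.adjoint g = A f + u₁ := by
    have h := add_mem (add_mem (hAA (A.mem_graph f)) hBu₁) (mem_graph_of_mem_pKer hu₀)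
    simpa using A.adjoint.mem_graph_snd_inj (A.adjoint.mem_graph g) h hg
  refine ⟨A.adjoint.mem_graph_snd_inj (A.adjoint.mem_graph ⟨_, huv⟩) hm rfl, ?_⟩
  have hpyth := norm_sq_add_eq_of_mem_graph_adjoint hdense hw fε
  rw [← hgε', ← add_sub_assoc, ← hgε] at hpyth
  set m := uε - vε
  set w := ((ε : ℂ) * I) • (uε + vε)
  have hAh : w - u₁ = A (f - fε) := by
    rw [A.map_sub, sub_eq_sub_iff_add_eq_add, add_comm w, ← hgε', hg']
  have hinner : ⟪A (f - fε), A (f - fε)⟫ = ⟪A (f - fε), w⟫ := by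
    have h := inner_apply_eq_inner_of_mem_graph_adjoint hdense (mem_graph_of_mem_pKer hu₁) (f - fε)
    rw [zero_smul, inner_zero_right] at h
    rw [← sub_zero ⟪A (f - fε), w⟫, ← h, ← inner_sub_right, hAh]
  have hnorm : ‖A (f - fε)‖ ^ 2 = ‖⟪A (f - fε), w⟫‖ := by
    rw [← hinner, inner_self_eq_norm_sq_to_K]
    simp
  have hle_w : ‖A (f - fε)‖ ≤ ‖w‖ := by
    refine le_of_sq_le_mul (norm_nonneg _) (norm_nonneg _) ?_
    rw [hnorm]
    exact norm_inner_le_norm _ _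
  have hle_m : ‖A (f - fε)‖ ≤ ε ^ 2 * C * ‖m‖ := by
    refine le_of_sq_le_mul (norm_nonneg _) (by positivity) ?_
    rw [hnorm, inner_apply_eq_inner_of_mem_graph_adjoint hdense hw]
    calc ‖⟪((f - fε : A.domain) : H), -((ε : ℂ) ^ 2) • m⟫‖
        ≤ ‖((f - fε : A.domain) : H)‖ * ‖-((ε : ℂ) ^ 2) • m‖ := norm_inner_le_norm _ _
      _ = ‖((f - fε : A.domain) : H)‖ * (ε ^ 2 * ‖m‖) := by simp [norm_smul]
      _ ≤ C * ‖A (f - fε)‖ * (ε ^ 2 * ‖m‖) := by gcongr; exact hbound _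
      _ = ‖A (f - fε)‖ * (ε ^ 2 * C * ‖m‖) := by ring
  have hsum : 0 ≤ ‖A.adjoint g‖ + ε * ‖(g : H)‖ := by positivity
  have hcross : 0 ≤ ‖A.adjoint g‖ * (ε * ‖(g : H)‖) := by positivity
  have hw_le : ‖w‖ ≤ ‖A.adjoint g‖ + ε * ‖(g : H)‖ := by
    refine (sq_le_sq₀ (by positivity) hsum).1 ?_
    nlinarith [sq_nonneg ‖A fε‖, sq_nonneg (ε * ‖(fε : H)‖), sq_nonneg (ε * ‖m‖)]
  have hm_le : ε * ‖m‖ ≤ ‖A.adjoint g‖ + ε * ‖(g : H)‖ := by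
    refine (sq_le_sq₀ (by positivity) hsum).1 ?_
    nlinarith [sq_nonneg ‖A fε‖, sq_nonneg (ε * ‖(fε : H)‖), sq_nonneg ‖w‖]
  rw [hAh]
  rcases le_total (ε * C) 1 with h | h
  · calc ‖A (f - fε)‖ ≤ ε * C * (ε * ‖m‖) := by linarith
      _ ≤ ε * C * (‖A.adjoint g‖ + ε * ‖(g : H)‖) := by gcongr
      _ ≤ ε * (‖(g : H)‖ + C * ‖A.adjoint g‖) := by
        nlinarith [mul_le_mul_of_nonneg_right h (by positivity : 0 ≤ ε * ‖(g : H)‖)]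
  · nlinarith [mul_le_mul_of_nonneg_right h (norm_nonneg (A.adjoint g))]
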